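/- arXiv:2510.04915 — 6 statements merged into one kernel-verified Lean document; each statement's English description precedes it below -/
import Mathlib

section
/- For each agent i, the set function f_i is submodular: for all subsets S ⊆ T ⊆ M with S nonempty and every good ℓ ∉ T, f_i(S ∪ {ℓ}) − f_i(S) ≥ f_i(T ∪ {ℓ}) − f_i(T). -/
/-- For each agent `i`, the set function
`f_i(S) = Σ_{k∈S} v_{ki} − min_{k∈S} v_{ki}` is submodular: for all subsets
`S ⊆ T ⊆ M` with `S` nonempty and every good `ℓ ∉ T`,
`f_i(S ∪ {ℓ}) − f_i(S) ≥ f_i(T ∪ {ℓ}) − f_i(T)`. -/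
theorem stmt_0 (m n : ℕ) (hm : 1 ≤ m) (hn : 1 ≤ n)
    (v : Fin m → Fin n → ℝ) (hv : ∀ k i, 0 ≤ v k i) (i : Fin n)
    (S T : Finset (Fin m)) (hS : S.Nonempty) (hST : S ⊆ T)
    (ℓ : Fin m) (hℓT : ℓ ∉ T) :
    ((∑ k ∈ insert ℓ T, v k i) -
        (insert ℓ T).inf' (Finset.insert_nonempty ℓ T) (fun k => v k i))
      - ((∑ k ∈ T, v k i) - T.inf' (hS.mono hST) (fun k => v k i))
    ≤ ((∑ k ∈ insert ℓ S, v k i) -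
        (insert ℓ S).inf' (Finset.insert_nonempty ℓ S) (fun k => v k i))
      - ((∑ k ∈ S, v k i) - S.inf' hS (fun k => v k i)) := by
  have hmin := Finset.inf'_mono (fun k => v k i) hST hS
  rw [Finset.sum_insert hℓT, Finset.sum_insert (fun h => hℓT (hST h)),
    Finset.inf'_insert (hS.mono hST), Finset.inf'_insert hS]
  rcases min_cases (v ℓ i) (T.inf' (hS.mono hST) fun k => v k i) with h | h <;>
    rcases min_cases (v ℓ i) (S.inf' hS fun k => v k i) with h' | h' <;>
    linarith
end

section
/- For every fractional allocation x ∈ P and every λ > 0, the expected value of the maximum envy under row-wise independent rounding is bounded by g(x,λ): Σ_{σ : M → N} ( ∏_{ℓ=1}^m x_{ℓ,σ(ℓ)} ) · max{ f_i(X^σ_j) − Σ_{ℓ∈X^σ_i} v_{ℓi} : i ≠ j, X^σ_j nonempty } ≤ g(x, λ), where X^σ_i = { ℓ ∈ M : σ(ℓ) = i }. -/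
/-- Max of a row: `h(z) = max_r z_r` (realized as `sSup` of the finite range). -/
noncomputable def rowMax {n : ℕ} (z : Fin n → ℝ) : ℝ := sSup (Set.range z)

/-- The continuous-extension upper bound `g(x,λ)` from the paper. -/
noncomputable def gfun {m n : ℕ} (v x : Fin m → Fin n → ℝ) (lam : ℝ) : ℝ :=
  (1 / lam) * Real.log
    (∑ p ∈ Finset.univ.filter (fun p : Fin n × Fin n => p.1 ≠ p.2),
      ∑ k : Fin m, x k p.2 *
        ∏ ℓ ∈ Finset.univ.erase k,
          (1 - x ℓ p.1 - x ℓ p.2 + x ℓ p.1 * Real.exp (-lam * v ℓ p.1)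
            + x ℓ p.2 * Real.exp (lam * v ℓ p.1)))

/-- `X` is an EFX allocation: a partition of the goods such that for all agents
`i, j` and every good `k ∈ X_j`, `Σ_{ℓ∈X_i} v_{ℓi} ≥ Σ_{ℓ∈X_j} v_{ℓi} − v_{ki}`. -/
def IsEFX {m n : ℕ} (v : Fin m → Fin n → ℝ) (X : Fin n → Finset (Fin m)) : Prop :=
  (∀ i j, i ≠ j → Disjoint (X i) (X j)) ∧
  (Finset.univ.biUnion X = (Finset.univ : Finset (Fin m))) ∧
  (∀ i j : Fin n, ∀ k ∈ X j, (∑ ℓ ∈ X i, v ℓ i) ≥ (∑ ℓ ∈ X j, v ℓ i) - v k i)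

/-- `A_{kj}(y) = max_{i≠j} Σ_{ℓ≠k} ( h(y_ℓ + v_{ℓi}(e_j − e_i)) − h(y_ℓ) )`. -/
noncomputable def Amap {m n : ℕ} (v y : Fin m → Fin n → ℝ) (k : Fin m) (j : Fin n) : ℝ :=
  sSup { z : ℝ | ∃ i : Fin n, i ≠ j ∧
    z = ∑ ℓ ∈ Finset.univ.erase k,
      (rowMax (fun r => y ℓ r +
          v ℓ i * ((if r = j then (1 : ℝ) else 0) - (if r = i then (1 : ℝ) else 0)))
        - rowMax (y ℓ)) }

/-- The objective `f(y)` of Theorem `thm:f-y`; note that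
`max{ y_{ℓi} − v_{ℓi}, y_{ℓj} + v_{ℓi}, max_{r∉{i,j}} y_{ℓr} }` is exactly the max of
the row `y_ℓ + v_{ℓi}(e_j − e_i)` (and when `n = 2` the innermost max is absent). -/
noncomputable def fobj {m n : ℕ} (v y : Fin m → Fin n → ℝ) : ℝ :=
  sSup { z : ℝ | ∃ i j : Fin n, i ≠ j ∧ ∃ k : Fin m,
      z = y k j + ∑ ℓ ∈ Finset.univ.erase k,
        rowMax (fun r => y ℓ r +
          v ℓ i * ((if r = j then (1 : ℝ) else 0) - (if r = i then (1 : ℝ) else 0))) }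
    - ∑ ℓ, rowMax (y ℓ)

/-- The factor contributed by a good `ℓ` given to agent `r` to the exponential of `lam` times the
envy of agent `i` towards agent `j` after removing good `k`; it vanishes if `k` is not given
to `j`. -/
noncomputable def envyFactor {m n : ℕ} (v : Fin m → Fin n → ℝ) (lam : ℝ) (i j : Fin n)
    (k ℓ : Fin m) (r : Fin n) : ℝ :=
  if ℓ = k then (if r = j then 1 else 0)
  else if r = j then Real.exp (lam * v ℓ i)
  else if r = i then Real.exp (-lam * v ℓ i) else 1

lemma envyFactor_nonneg {m n : ℕ} (v : Fin m → Fin n → ℝ) (lam : ℝ) (i j : Fin n)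
    (k ℓ : Fin m) (r : Fin n) : 0 ≤ envyFactor v lam i j k ℓ r := by
  unfold envyFactor
  split_ifs <;> positivity

/-- The sum over `i ≠ j` and `k` of the exponentials of `lam` times the envy of `i` towards `j`
after removing `k ∈ X_j`. -/
noncomputable def envyExpSum {m n : ℕ} (v : Fin m → Fin n → ℝ) (lam : ℝ)
    (σ : Fin m → Fin n) : ℝ :=
  ∑ p ∈ Finset.univ.filter (fun p : Fin n × Fin n => p.1 ≠ p.2),
    ∑ k : Fin m, ∏ ℓ, envyFactor v lam p.1 p.2 k ℓ (σ ℓ)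

lemma exp_envy_eq_prod_envyFactor {m n : ℕ} (v : Fin m → Fin n → ℝ) (lam : ℝ) {i j : Fin n}
    (hij : i ≠ j) (σ : Fin m → Fin n) {k : Fin m} (hk : σ k = j) :
    Real.exp (lam * (((∑ ℓ ∈ Finset.univ.filter (fun ℓ => σ ℓ = j), v ℓ i) - v k i)
      - ∑ ℓ ∈ Finset.univ.filter (fun ℓ => σ ℓ = i), v ℓ i))
      = ∏ ℓ, envyFactor v lam i j k ℓ (σ ℓ) := by
  have hvk : v k i = ∑ ℓ, if ℓ = k then v ℓ i else 0 := by simp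
  rw [hvk, Finset.sum_filter, Finset.sum_filter, ← Finset.sum_sub_distrib,
    ← Finset.sum_sub_distrib, Finset.mul_sum, Real.exp_sum]
  refine Finset.prod_congr rfl fun ℓ _ => ?_
  unfold envyFactor
  by_cases h : ℓ = k
  · subst h
    simp [hk, hij.symm]
  · by_cases h1 : σ ℓ = j
    · simp [h, h1, hij.symm]
    · by_cases h2 : σ ℓ = i
      · simp [h, h2, hij]
      · simp [h, h1, h2]

lemma exp_envy_le_envyExpSum {m n : ℕ} (v : Fin m → Fin n → ℝ) (lam : ℝ) {i j : Fin n}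
    (hij : i ≠ j) (σ : Fin m → Fin n) {k : Fin m} (hk : σ k = j) :
    Real.exp (lam * (((∑ ℓ ∈ Finset.univ.filter (fun ℓ => σ ℓ = j), v ℓ i) - v k i)
      - ∑ ℓ ∈ Finset.univ.filter (fun ℓ => σ ℓ = i), v ℓ i)) ≤ envyExpSum v lam σ := by
  rw [exp_envy_eq_prod_envyFactor v lam hij σ hk]
  have hprod (p : Fin n × Fin n) (k' : Fin m) :
      0 ≤ ∏ ℓ, envyFactor v lam p.1 p.2 k' ℓ (σ ℓ) :=
    Finset.prod_nonneg fun ℓ _ => envyFactor_nonneg v lam p.1 p.2 k' ℓ (σ ℓ)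
  refine (Finset.single_le_sum (f := fun k' => ∏ ℓ, envyFactor v lam i j k' ℓ (σ ℓ))
    (fun k' _ => hprod (i, j) k') (Finset.mem_univ k)).trans ?_
  exact Finset.single_le_sum
    (f := fun p : Fin n × Fin n => ∑ k', ∏ ℓ, envyFactor v lam p.1 p.2 k' ℓ (σ ℓ))
    (fun p _ => Finset.sum_nonneg fun k' _ => hprod p k')
    (Finset.mem_filter.2 ⟨Finset.mem_univ (i, j), hij⟩)

lemma envyExpSum_pos {m n : ℕ} (hm : 1 ≤ m) (hn : 2 ≤ n) (v : Fin m → Fin n → ℝ) (lam : ℝ)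
    (σ : Fin m → Fin n) : 0 < envyExpSum v lam σ := by
  have : Nontrivial (Fin n) := Fin.nontrivial_iff_two_le.2 hn
  obtain ⟨i, hi⟩ := exists_ne (σ ⟨0, hm⟩)
  exact (Real.exp_pos _).trans_le (exp_envy_le_envyExpSum v lam hi σ rfl)

/-- The expectation of a product of functions of independently rounded rows is the product of
the expectations. -/
lemma sum_prod_mul_prod {m n : ℕ} (x F : Fin m → Fin n → ℝ) :
    ∑ σ : Fin m → Fin n, (∏ ℓ, x ℓ (σ ℓ)) * ∏ ℓ, F ℓ (σ ℓ) = ∏ ℓ, ∑ r, x ℓ r * F ℓ r := by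
  rw [Finset.prod_univ_sum, Fintype.piFinset_univ]
  simp only [Finset.prod_mul_distrib]

lemma sum_mul_envyFactor_of_ne {m n : ℕ} (v x : Fin m → Fin n → ℝ)
    (hxsum : ∀ ℓ, ∑ i, x ℓ i = 1) (lam : ℝ) {i j : Fin n} (hij : i ≠ j) {k ℓ : Fin m}
    (h : ℓ ≠ k) :
    ∑ r, x ℓ r * envyFactor v lam i j k ℓ r =
      1 - x ℓ i - x ℓ j + x ℓ i * Real.exp (-lam * v ℓ i) + x ℓ j * Real.exp (lam * v ℓ i) := by
  have key (r : Fin n) : x ℓ r * envyFactor v lam i j k ℓ r =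
      x ℓ r + (if r = i then x ℓ r * (Real.exp (-lam * v ℓ i) - 1) else 0)
        + (if r = j then x ℓ r * (Real.exp (lam * v ℓ i) - 1) else 0) := by
    unfold envyFactor
    by_cases h1 : r = j
    · subst h1
      simp only [h, hij.symm, if_true, if_false]
      ring
    · by_cases h2 : r = i
      · subst h2
        simp only [h, hij, if_true, if_false]
        ring
      · simp [h, h1, h2]
  simp only [key, Finset.sum_add_distrib, hxsum, Finset.sum_ite_eq', Finset.mem_univ, if_true]
  ring

lemma sum_mul_envyExpSum {m n : ℕ} (v x : Fin m → Fin n → ℝ)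
    (hxsum : ∀ ℓ, ∑ i, x ℓ i = 1) (lam : ℝ) :
    ∑ σ : Fin m → Fin n, (∏ ℓ, x ℓ (σ ℓ)) * envyExpSum v lam σ =
      ∑ p ∈ Finset.univ.filter (fun p : Fin n × Fin n => p.1 ≠ p.2),
        ∑ k : Fin m, x k p.2 *
          ∏ ℓ ∈ Finset.univ.erase k,
            (1 - x ℓ p.1 - x ℓ p.2 + x ℓ p.1 * Real.exp (-lam * v ℓ p.1)
              + x ℓ p.2 * Real.exp (lam * v ℓ p.1)) := by
  simp only [envyExpSum, Finset.mul_sum]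
  rw [Finset.sum_comm]
  refine Finset.sum_congr rfl fun p hp => ?_
  rw [Finset.sum_comm]
  refine Finset.sum_congr rfl fun k _ => ?_
  rw [sum_prod_mul_prod x (envyFactor v lam p.1 p.2 k),
    ← Finset.mul_prod_erase _ _ (Finset.mem_univ k)]
  congr 1
  · simp [envyFactor]
  · exact Finset.prod_congr rfl fun ℓ hℓ =>
      sum_mul_envyFactor_of_ne v x hxsum lam (Finset.mem_filter.1 hp).2 (Finset.ne_of_mem_erase hℓ)

/-- For every fractional allocation `x ∈ P` and every `λ > 0`, the
expected value of the maximum envy under row-wise independent rounding is bounded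
by `g(x,λ)`:
`Σ_σ (∏_ℓ x_{ℓ,σ(ℓ)}) · max{ f_i(X^σ_j) − Σ_{ℓ∈X^σ_i} v_{ℓi} : i ≠ j, X^σ_j ≠ ∅ } ≤ g(x,λ)`
where `X^σ_i = { ℓ : σ(ℓ) = i }`. -/
theorem stmt_5 (m n : ℕ) (hm : 1 ≤ m) (hn : 2 ≤ n)
    (v : Fin m → Fin n → ℝ) (hv : ∀ k i, 0 ≤ v k i)
    (x : Fin m → Fin n → ℝ) (hx01 : ∀ ℓ i, x ℓ i ∈ Set.Icc (0 : ℝ) 1)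
    (hxsum : ∀ ℓ, ∑ i, x ℓ i = 1) (lam : ℝ) (hlam : 0 < lam) :
    ∑ σ : Fin m → Fin n, (∏ ℓ, x ℓ (σ ℓ)) *
      sSup { z : ℝ | ∃ i j : Fin n, i ≠ j ∧
        ∃ hj : (Finset.univ.filter (fun ℓ => σ ℓ = j)).Nonempty,
        z = ((∑ k ∈ Finset.univ.filter (fun ℓ => σ ℓ = j), v k i)
              - (Finset.univ.filter (fun ℓ => σ ℓ = j)).inf' hj (fun k => v k i))
            - ∑ ℓ ∈ Finset.univ.filter (fun ℓ' => σ ℓ' = i), v ℓ i }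
      ≤ gfun v x lam := by
  have hp0 (σ : Fin m → Fin n) : 0 ≤ ∏ ℓ, x ℓ (σ ℓ) :=
    Finset.prod_nonneg fun ℓ _ => (hx01 ℓ (σ ℓ)).1
  have hp1 : ∑ σ : Fin m → Fin n, ∏ ℓ, x ℓ (σ ℓ) = 1 := by
    have h := sum_prod_mul_prod x (fun _ _ => 1)
    simpa [hxsum] using h
  have jensen := strictConcaveOn_log_Ioi.concaveOn.le_map_sum (t := Finset.univ)
    (w := fun σ : Fin m → Fin n => ∏ ℓ, x ℓ (σ ℓ)) (p := fun σ => envyExpSum v lam σ)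
    (fun σ _ => hp0 σ) hp1 (fun σ _ => envyExpSum_pos hm hn v lam σ)
  simp only [smul_eq_mul] at jensen
  rw [sum_mul_envyExpSum v x hxsum lam] at jensen
  refine le_trans ?_ (mul_le_mul_of_nonneg_left jensen (one_div_pos.2 hlam).le)
  rw [Finset.mul_sum]
  refine Finset.sum_le_sum fun σ _ => ?_
  rw [mul_left_comm]
  refine mul_le_mul_of_nonneg_left (csSup_le ?_ ?_) (hp0 σ)
  · have : Nontrivial (Fin n) := Fin.nontrivial_iff_two_le.2 hn
    obtain ⟨i, hi⟩ := exists_ne (σ ⟨0, hm⟩)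
    exact ⟨_, i, _, hi, ⟨⟨0, hm⟩, Finset.mem_filter.2 ⟨Finset.mem_univ _, rfl⟩⟩, rfl⟩
  · rintro z ⟨i, j, hij, hj, rfl⟩
    obtain ⟨k, hk, hmin⟩ := Finset.exists_mem_eq_inf' hj (fun k => v k i)
    rw [hmin, one_div, ← div_eq_inv_mul, le_div_iff₀' hlam,
      Real.le_log_iff_exp_le (envyExpSum_pos hm hn v lam σ)]
    exact exp_envy_le_envyExpSum v lam hij σ (Finset.mem_filter.1 hk).2
end

section
/- An EFX allocation exists if and only if inf{ g(x,λ) : x ∈ P, λ > 0 } ≤ 0; equivalently, an EFX allocation exists if and only if for every δ > 0 there exist x ∈ P and λ > 0 with g(x,λ) < δ. -/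
/-- The envy of agent `i` towards agent `j`, with good `k` ignored, when good `ℓ` goes to
agent `a ℓ`. -/
def envyErase {m n : ℕ} (v : Fin m → Fin n → ℝ) (a : Fin m → Fin n) (i j : Fin n)
    (k : Fin m) : ℝ :=
  ∑ ℓ ∈ Finset.univ.erase k,
    v ℓ i * ((if a ℓ = j then (1 : ℝ) else 0) - (if a ℓ = i then (1 : ℝ) else 0))

theorem envyErase_eq {m n : ℕ} (v : Fin m → Fin n → ℝ) (a : Fin m → Fin n) {i j : Fin n}
    (hij : i ≠ j) {k : Fin m} (hk : a k = j) :
    envyErase v a i j k =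
      (∑ ℓ ∈ Finset.univ.filter (fun ℓ => a ℓ = j), v ℓ i) - v k i
        - ∑ ℓ ∈ Finset.univ.filter (fun ℓ => a ℓ = i), v ℓ i := by
  have h := Finset.add_sum_erase Finset.univ (fun ℓ => v ℓ i *
    ((if a ℓ = j then (1 : ℝ) else 0) - (if a ℓ = i then (1 : ℝ) else 0))) (Finset.mem_univ k)
  simp only [hk, if_true, if_neg hij.symm, mul_sub, Finset.sum_sub_distrib, mul_ite, mul_one,
    mul_zero, sub_zero] at h
  simp only [envyErase, mul_sub, Finset.sum_sub_distrib, mul_ite, mul_one, mul_zero,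
    Finset.sum_filter]
  linarith

theorem isEFX_fibers_iff {m n : ℕ} {v : Fin m → Fin n → ℝ} (hv : ∀ k i, 0 ≤ v k i)
    (a : Fin m → Fin n) :
    IsEFX v (fun j => Finset.univ.filter (fun ℓ => a ℓ = j)) ↔
      ∀ i j k, i ≠ j → a k = j → envyErase v a i j k ≤ 0 := by
  constructor
  · rintro ⟨-, -, h⟩ i j k hij hk
    have := h i j k (by simpa using hk)
    rw [envyErase_eq v a hij hk]
    linarith
  · intro h
    refine ⟨fun i j hij => ?_, ?_, fun i j k hk => ?_⟩
    · rw [Finset.disjoint_left]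
      intro ℓ hi hj
      simp only [Finset.mem_filter, Finset.mem_univ, true_and] at hi hj
      exact hij (hi.symm.trans hj)
    · ext ℓ
      simp
    · have hk' : a k = j := by simpa using hk
      by_cases hij : i = j
      · subst hij
        linarith [hv k i]
      · have := h i j k hij hk'
        rw [envyErase_eq v a hij hk'] at this
        linarith

theorem IsEFX.exists_fibers {m n : ℕ} {v : Fin m → Fin n → ℝ} {X : Fin n → Finset (Fin m)}
    (hX : IsEFX v X) :
    ∃ a : Fin m → Fin n, X = fun j => Finset.univ.filter (fun ℓ => a ℓ = j) := by
  have hcov : ∀ ℓ, ∃ j, ℓ ∈ X j := fun ℓ => by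
    have : ℓ ∈ Finset.univ.biUnion X := hX.2.1 ▸ Finset.mem_univ ℓ
    simpa using this
  choose a ha using hcov
  refine ⟨a, funext fun j => Finset.ext fun ℓ => ?_⟩
  simp only [Finset.mem_filter, Finset.mem_univ, true_and]
  refine ⟨fun h => ?_, fun h => h ▸ ha ℓ⟩
  by_contra hne
  exact Finset.disjoint_left.mp (hX.1 _ _ hne) (ha ℓ) h

theorem factor_eq_sum {n : ℕ} {y : Fin n → ℝ} (hy : ∑ r, y r = 1) {i j : Fin n} (hij : i ≠ j)
    (lam w : ℝ) :
    1 - y i - y j + y i * Real.exp (-lam * w) + y j * Real.exp (lam * w) =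
      ∑ r, y r * Real.exp
        (lam * (w * ((if r = j then (1 : ℝ) else 0) - (if r = i then (1 : ℝ) else 0)))) := by
  have key : ∀ r, y r * Real.exp
      (lam * (w * ((if r = j then (1 : ℝ) else 0) - (if r = i then (1 : ℝ) else 0)))) =
      y r + (if r = i then y r * (Real.exp (-lam * w) - 1) else 0)
        + (if r = j then y r * (Real.exp (lam * w) - 1) else 0) := by
    intro r
    by_cases hi : r = i
    · have hj : r ≠ j := fun h => hij (hi.symm.trans h)
      simp only [if_pos hi, if_neg hj]
      rw [show lam * (w * ((0 : ℝ) - 1)) = -lam * w by ring]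
      ring
    · by_cases hj : r = j
      · simp only [if_pos hj, if_neg hi]
        rw [show lam * (w * ((1 : ℝ) - 0)) = lam * w by ring]
        ring
      · simp [hi, hj]
  simp only [key, Finset.sum_add_distrib, hy, Finset.sum_ite_eq', Finset.mem_univ, if_true]
  ring

/-- The argument of the logarithm in `gfun`. -/
noncomputable def expSum {m n : ℕ} (v x : Fin m → Fin n → ℝ) (lam : ℝ) : ℝ :=
  ∑ p ∈ Finset.univ.filter (fun p : Fin n × Fin n => p.1 ≠ p.2),
    ∑ k : Fin m, x k p.2 *
      ∏ ℓ ∈ Finset.univ.erase k,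
        (1 - x ℓ p.1 - x ℓ p.2 + x ℓ p.1 * Real.exp (-lam * v ℓ p.1)
          + x ℓ p.2 * Real.exp (lam * v ℓ p.1))

theorem gfun_eq {m n : ℕ} (v x : Fin m → Fin n → ℝ) (lam : ℝ) :
    gfun v x lam = 1 / lam * Real.log (expSum v x lam) := rfl

/-- One summand of `expSum` as an expectation over independent random assignments of goods. -/
theorem mul_prod_factor_eq_sum {m n : ℕ} (v : Fin m → Fin n → ℝ) {x : Fin m → Fin n → ℝ}
    (hx : ∀ ℓ, ∑ i, x ℓ i = 1) (lam : ℝ) {i j : Fin n} (hij : i ≠ j) (k : Fin m) :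
    x k j * ∏ ℓ ∈ Finset.univ.erase k,
        (1 - x ℓ i - x ℓ j + x ℓ i * Real.exp (-lam * v ℓ i)
          + x ℓ j * Real.exp (lam * v ℓ i)) =
      ∑ a : Fin m → Fin n, (∏ ℓ, x ℓ (a ℓ)) *
        (if a k = j then Real.exp (lam * envyErase v a i j k) else 0) := by
  let W : Fin m → Fin n → ℝ := fun ℓ r =>
    if ℓ = k then (if r = j then 1 else 0) else Real.exp
      (lam * (v ℓ i * ((if r = j then (1 : ℝ) else 0) - (if r = i then (1 : ℝ) else 0))))
  have hW : ∀ a : Fin m → Fin n,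
      ∏ ℓ, W ℓ (a ℓ) = if a k = j then Real.exp (lam * envyErase v a i j k) else 0 := by
    intro a
    rw [← Finset.mul_prod_erase Finset.univ _ (Finset.mem_univ k), envyErase, Finset.mul_sum,
      Real.exp_sum, ← boole_mul]
    refine congrArg₂ (· * ·) (by simp [W]) (Finset.prod_congr rfl fun ℓ hℓ => ?_)
    simp only [W, if_neg (Finset.ne_of_mem_erase hℓ)]
  calc _ = ∏ ℓ, ∑ r, x ℓ r * W ℓ r := by
        rw [← Finset.mul_prod_erase Finset.univ _ (Finset.mem_univ k)]
        refine congrArg₂ (· * ·) (by simp [W]) (Finset.prod_congr rfl fun ℓ hℓ => ?_)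
        rw [factor_eq_sum (hx ℓ) hij]
        simp only [W, if_neg (Finset.ne_of_mem_erase hℓ)]
    _ = ∑ a : Fin m → Fin n, ∏ ℓ, x ℓ (a ℓ) * W ℓ (a ℓ) := by
        rw [Finset.prod_univ_sum, Fintype.piFinset_univ]
    _ = _ := by simp only [Finset.prod_mul_distrib, hW]

/-- The sum of exponentiated envies of the assignment `a`. -/
noncomputable def envySum {m n : ℕ} (v : Fin m → Fin n → ℝ) (lam : ℝ) (a : Fin m → Fin n) : ℝ :=
  ∑ p ∈ Finset.univ.filter (fun p : Fin n × Fin n => p.1 ≠ p.2),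
    ∑ k : Fin m, if a k = p.2 then Real.exp (lam * envyErase v a p.1 p.2 k) else 0

theorem expSum_eq {m n : ℕ} (v : Fin m → Fin n → ℝ) {x : Fin m → Fin n → ℝ}
    (hx : ∀ ℓ, ∑ i, x ℓ i = 1) (lam : ℝ) :
    expSum v x lam = ∑ a : Fin m → Fin n, (∏ ℓ, x ℓ (a ℓ)) * envySum v lam a := by
  simp only [envySum, Finset.mul_sum]
  rw [Finset.sum_comm]
  refine Finset.sum_congr rfl fun p hp => ?_
  rw [Finset.sum_comm]
  exact Finset.sum_congr rfl fun k _ =>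
    mul_prod_factor_eq_sum v hx lam (Finset.mem_filter.mp hp).2 k

theorem sum_prod_eq_one {m n : ℕ} {x : Fin m → Fin n → ℝ} (hx : ∀ ℓ, ∑ i, x ℓ i = 1) :
    ∑ a : Fin m → Fin n, ∏ ℓ, x ℓ (a ℓ) = 1 := by
  rw [← Fintype.piFinset_univ, ← Finset.prod_univ_sum]
  simp [hx]

theorem expSum_indicator {m n : ℕ} (v : Fin m → Fin n → ℝ) (a : Fin m → Fin n) (lam : ℝ) :
    expSum v (fun ℓ i => if a ℓ = i then 1 else 0) lam = envySum v lam a := by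
  rw [expSum_eq v (by simp), Finset.sum_eq_single a]
  · simp
  · intro b _ hb
    obtain ⟨ℓ, hℓ⟩ := Function.ne_iff.mp hb
    rw [Finset.prod_eq_zero (Finset.mem_univ ℓ) (if_neg hℓ.symm), zero_mul]
  · simp

theorem exp_le_envySum {m n : ℕ} (v : Fin m → Fin n → ℝ) (lam : ℝ) {a : Fin m → Fin n}
    {i j : Fin n} {k : Fin m} (hij : i ≠ j) (hk : a k = j) :
    Real.exp (lam * envyErase v a i j k) ≤ envySum v lam a := by
  have hnn : ∀ (p : Fin n × Fin n) (k : Fin m),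
      0 ≤ if a k = p.2 then Real.exp (lam * envyErase v a p.1 p.2 k) else 0 := fun p k => by
    split_ifs
    · positivity
    · exact le_rfl
  refine le_trans ?_ (Finset.single_le_sum (fun p _ => Finset.sum_nonneg fun k _ => hnn p k)
    (show (i, j) ∈ _ by simpa using hij))
  refine le_trans ?_ (Finset.single_le_sum (fun k _ => hnn (i, j) k) (Finset.mem_univ k))
  simp [hk]

theorem envySum_le {m n : ℕ} {v : Fin m → Fin n → ℝ} {lam : ℝ} (hlam : 0 ≤ lam)
    {a : Fin m → Fin n} (h : ∀ i j k, i ≠ j → a k = j → envyErase v a i j k ≤ 0) :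
    envySum v lam a ≤ n * n * m := by
  calc envySum v lam a
      ≤ ∑ p ∈ Finset.univ.filter (fun p : Fin n × Fin n => p.1 ≠ p.2), ∑ _k : Fin m, (1 : ℝ) := by
        refine Finset.sum_le_sum fun p hp => Finset.sum_le_sum fun k _ => ?_
        split_ifs with hk
        · exact Real.exp_le_one_iff.mpr (mul_nonpos_of_nonneg_of_nonpos hlam
            (h _ _ _ (Finset.mem_filter.mp hp).2 hk))
        · exact zero_le_one
    _ ≤ ∑ p : Fin n × Fin n, ∑ _k : Fin m, (1 : ℝ) :=
        Finset.sum_le_sum_of_subset_of_nonneg (Finset.filter_subset _ _)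
          fun _ _ _ => by positivity
    _ = n * n * m := by simp

/-- An EFX allocation exists if and only if
`inf{ g(x,λ) : x ∈ P, λ > 0 } ≤ 0`; equivalently, an EFX allocation exists if and
only if for every `δ > 0` there exist `x ∈ P` and `λ > 0` with `g(x,λ) < δ`. -/
theorem stmt_6 (m n : ℕ) (hm : 1 ≤ m) (hn : 2 ≤ n)
    (v : Fin m → Fin n → ℝ) (hv : ∀ k i, 0 ≤ v k i) :
    (∃ X : Fin n → Finset (Fin m), IsEFX v X) ↔
      (∀ δ : ℝ, 0 < δ → ∃ x : Fin m → Fin n → ℝ,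
        (∀ ℓ i, x ℓ i ∈ Set.Icc (0 : ℝ) 1) ∧ (∀ ℓ, ∑ i, x ℓ i = 1) ∧
        ∃ lam : ℝ, 0 < lam ∧ gfun v x lam < δ) := by
  constructor
  · rintro ⟨X, hX⟩ δ hδ
    obtain ⟨a, rfl⟩ := hX.exists_fibers
    rw [isEFX_fibers_iff hv] at hX
    obtain ⟨lam, hlam, hlt⟩ : ∃ lam : ℝ, 0 < lam ∧ Real.log (n * n * m) < δ * lam :=
      ((Filter.eventually_gt_atTop 0).and
        ((Filter.tendsto_id.const_mul_atTop hδ).eventually_gt_atTop _)).exists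
    refine ⟨fun ℓ i => if a ℓ = i then 1 else 0, fun ℓ i => ?_, by simp, lam, hlam, ?_⟩
    · dsimp only
      split_ifs <;> simp
    · obtain ⟨i, hi⟩ : ∃ i : Fin n, i ≠ a ⟨0, hm⟩ := by
        have : Nontrivial (Fin n) := Fin.nontrivial_iff_two_le.mpr hn
        exact exists_ne _
      have hpos := (Real.exp_pos _).trans_le (exp_le_envySum v lam hi rfl)
      rw [gfun_eq, expSum_indicator, one_div, inv_mul_lt_iff₀ hlam, mul_comm lam]
      exact (Real.log_le_log hpos (envySum_le hlam.le hX)).trans_lt hlt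
  · intro h
    by_contra hno
    have hviol : ∀ a : Fin m → Fin n, ∃ i j k, i ≠ j ∧ a k = j ∧ 0 < envyErase v a i j k := by
      intro a
      by_contra! hc
      exact hno ⟨_, (isEFX_fibers_iff hv a).mpr hc⟩
    choose I J K hIJ hKJ hpos using hviol
    have : Nonempty (Fin n) := ⟨⟨0, by omega⟩⟩
    obtain ⟨b, hb⟩ := Finite.exists_min fun a => envyErase v a (I a) (J a) (K a)
    obtain ⟨x, hx01, hx, lam, hlam, hlt⟩ := h _ (hpos b)
    refine hlt.not_ge ?_
    have hS : Real.exp (lam * envyErase v b (I b) (J b) (K b)) ≤ expSum v x lam := by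
      rw [expSum_eq v hx, ← one_mul (Real.exp _), ← sum_prod_eq_one hx, Finset.sum_mul]
      refine Finset.sum_le_sum fun a _ => mul_le_mul_of_nonneg_left ?_
        (Finset.prod_nonneg fun ℓ _ => (hx01 ℓ _).1)
      exact (Real.exp_le_exp.mpr (mul_le_mul_of_nonneg_left (hb a) hlam.le)).trans
        (exp_le_envySum v lam (hIJ a) (hKJ a))
    rw [gfun_eq, one_div, le_inv_mul_iff₀ hlam]
    exact (Real.le_log_iff_exp_le ((Real.exp_pos _).trans_le hS)).mpr hS
end

section
/- If X* is an EFX allocation and x = 1_{X*} ∈ P is its 0/1 indicator matrix (x_{kj} = 1 iff k ∈ X*_j), then for every λ > 0, g(1_{X*}, λ) ≤ ln(nm)/λ. -/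
/-- For disjoint bundles the factors of `gfun` at an indicator matrix are exponentials. -/
lemma indicator_factor_eq_exp {α : Type*} [DecidableEq α] {A B : Finset α} (hAB : Disjoint A B)
    (w : α → ℝ) (lam : ℝ) (l : α) :
    (1 - (if l ∈ A then (1 : ℝ) else 0) - (if l ∈ B then (1 : ℝ) else 0)
        + (if l ∈ A then (1 : ℝ) else 0) * Real.exp (-lam * w l)
        + (if l ∈ B then (1 : ℝ) else 0) * Real.exp (lam * w l))
      = Real.exp (lam * ((if l ∈ B then w l else 0) - (if l ∈ A then w l else 0))) := by
  by_cases hA : l ∈ A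
  · have hB : l ∉ B := Finset.disjoint_left.mp hAB hA
    simp [hA, hB]
  · by_cases hB : l ∈ B <;> simp [hA, hB]

/-- The product of the factors of `gfun` over all goods other than `k ∈ B` is the exponential of
`lam` times the envy of the owner of `A` towards `B` without `k`. -/
lemma prod_indicator_factor {α : Type*} [Fintype α] [DecidableEq α] {A B : Finset α}
    (hAB : Disjoint A B) (w : α → ℝ) (lam : ℝ) {k : α} (hk : k ∈ B) :
    ∏ l ∈ Finset.univ.erase k, (1 - (if l ∈ A then (1 : ℝ) else 0) - (if l ∈ B then (1 : ℝ) else 0)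
        + (if l ∈ A then (1 : ℝ) else 0) * Real.exp (-lam * w l)
        + (if l ∈ B then (1 : ℝ) else 0) * Real.exp (lam * w l))
      = Real.exp (lam * ((∑ l ∈ B, w l) - w k - ∑ l ∈ A, w l)) := by
  have hkA : k ∉ A := Finset.disjoint_right.mp hAB hk
  simp only [indicator_factor_eq_exp hAB]
  rw [← Real.exp_sum, ← Finset.mul_sum, Finset.sum_erase_eq_sub (Finset.mem_univ k),
    Finset.sum_sub_distrib]
  simp only [Finset.sum_ite_mem, Finset.univ_inter, hk, hkA, if_true, if_false]
  ring_nf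

/-- In an allocation every good has exactly one owner. -/
lemma IsEFX.sum_indicator {m n : ℕ} {v : Fin m → Fin n → ℝ} {X : Fin n → Finset (Fin m)}
    (hX : IsEFX v X) (k : Fin m) : ∑ j, (if k ∈ X j then (1 : ℝ) else 0) = 1 := by
  obtain ⟨j, -, hj⟩ := Finset.mem_biUnion.mp (hX.2.1 ▸ Finset.mem_univ k)
  rw [Finset.sum_eq_single j _ (by simp), if_pos hj]
  intro i _ hij
  exact if_neg fun hi => Finset.disjoint_left.mp (hX.1 i j hij) hi hj

/-- If `X*` is an EFX allocation and `x = 1_{X*} ∈ P` is its 0/1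
indicator matrix, then for every `λ > 0`, `g(1_{X*}, λ) ≤ ln(nm)/λ`. -/
theorem stmt_7 (m n : ℕ) (hm : 1 ≤ m) (hn : 2 ≤ n)
    (v : Fin m → Fin n → ℝ) (hv : ∀ k i, 0 ≤ v k i)
    (X : Fin n → Finset (Fin m)) (hX : IsEFX v X)
    (lam : ℝ) (hlam : 0 < lam) :
    gfun v (fun k j => if k ∈ X j then (1 : ℝ) else 0) lam
      ≤ Real.log ((n : ℝ) * (m : ℝ)) / lam := by
  have hterm : ∀ p ∈ Finset.univ.filter (fun p : Fin n × Fin n => p.1 ≠ p.2), ∀ k : Fin m,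
      0 ≤ (if k ∈ X p.2 then (1 : ℝ) else 0) *
        ∏ ℓ ∈ Finset.univ.erase k,
          (1 - (if ℓ ∈ X p.1 then (1 : ℝ) else 0) - (if ℓ ∈ X p.2 then (1 : ℝ) else 0)
            + (if ℓ ∈ X p.1 then (1 : ℝ) else 0) * Real.exp (-lam * v ℓ p.1)
            + (if ℓ ∈ X p.2 then (1 : ℝ) else 0) * Real.exp (lam * v ℓ p.1)) ∧
      (if k ∈ X p.2 then (1 : ℝ) else 0) *
        ∏ ℓ ∈ Finset.univ.erase k,
          (1 - (if ℓ ∈ X p.1 then (1 : ℝ) else 0) - (if ℓ ∈ X p.2 then (1 : ℝ) else 0)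
            + (if ℓ ∈ X p.1 then (1 : ℝ) else 0) * Real.exp (-lam * v ℓ p.1)
            + (if ℓ ∈ X p.2 then (1 : ℝ) else 0) * Real.exp (lam * v ℓ p.1))
        ≤ if k ∈ X p.2 then (1 : ℝ) else 0 := by
    intro p hp k
    by_cases hk : k ∈ X p.2
    · rw [prod_indicator_factor (hX.1 _ _ (Finset.mem_filter.mp hp).2) (fun l => v l p.1) lam hk]
      simp only [hk, if_true, one_mul]
      refine ⟨(Real.exp_pos _).le, Real.exp_le_one_iff.mpr ?_⟩
      exact mul_nonpos_of_nonneg_of_nonpos hlam.le (by linarith [hX.2.2 p.1 p.2 k hk])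
    · simp [hk]
  have hcount : ∑ p : Fin n × Fin n, ∑ k : Fin m, (if k ∈ X p.2 then (1 : ℝ) else 0)
      = (n : ℝ) * m := by
    rw [Finset.sum_comm]
    simp only [Fintype.sum_prod_type, hX.sum_indicator]
    simp [mul_comm]
  have hone : (1 : ℝ) ≤ (n : ℝ) * m := by
    exact_mod_cast Nat.mul_pos (by omega) hm
  have hbound := (Finset.sum_le_sum fun p hp =>
    Finset.sum_le_sum fun k (_ : k ∈ Finset.univ) => (hterm p hp k).2).trans
    (Finset.sum_le_univ_sum_of_nonneg fun p : Fin n × Fin n =>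
      Finset.sum_nonneg fun k (_ : k ∈ Finset.univ) => by positivity)
  have hnonneg := Finset.sum_nonneg fun p hp =>
    Finset.sum_nonneg fun k (_ : k ∈ Finset.univ) => (hterm p hp k).1
  rw [hcount] at hbound
  rw [gfun, one_div, div_eq_inv_mul]
  refine mul_le_mul_of_nonneg_left ?_ (inv_pos.mpr hlam).le
  rcases hnonneg.eq_or_lt with h | h
  · rw [← h, Real.log_zero]
    exact Real.log_nonneg hone
  · exact Real.log_le_log h hbound
end

section
/- An EFX allocation exists if and only if inf_{y ∈ ℝ^{m×n}} f(y) ≤ 0; equivalently, an EFX allocation exists if and only if for every δ > 0 there exists y ∈ ℝ^{m×n} with f(y) < δ. -/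
theorem le_rowMax {n : ℕ} (z : Fin n → ℝ) (r : Fin n) : z r ≤ rowMax z :=
  le_csSup (Set.finite_range z).bddAbove ⟨r, rfl⟩

theorem rowMax_le {n : ℕ} [Nonempty (Fin n)] {z : Fin n → ℝ} {c : ℝ} (h : ∀ r, z r ≤ c) :
    rowMax z ≤ c :=
  csSup_le (Set.range_nonempty z) (Set.forall_mem_range.2 h)

theorem exists_eq_rowMax {n : ℕ} [Nonempty (Fin n)] (z : Fin n → ℝ) : ∃ r, z r = rowMax z :=
  (Set.range_nonempty z).csSup_mem (Set.finite_range z)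

/-- Each triple `(i, j, k)` with `i ≠ j` gives a lower bound on the objective. -/
theorem le_fobj {m n : ℕ} (v y : Fin m → Fin n → ℝ) {i j : Fin n} (hij : i ≠ j) (k : Fin m) :
    y k j + ∑ ℓ ∈ Finset.univ.erase k,
        rowMax (fun r => y ℓ r +
          v ℓ i * ((if r = j then (1 : ℝ) else 0) - (if r = i then (1 : ℝ) else 0)))
      - ∑ ℓ, rowMax (y ℓ) ≤ fobj v y := by
  refine sub_le_sub_right (le_csSup (Set.Finite.bddAbove ?_) ?_) _
  swap
  · exact ⟨i, j, hij, k, rfl⟩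
  refine (Set.finite_range fun p : Fin n × Fin n × Fin m =>
    y p.2.2 p.2.1 + ∑ ℓ ∈ Finset.univ.erase p.2.2,
      rowMax (fun r => y ℓ r + v ℓ p.1 *
        ((if r = p.2.1 then (1 : ℝ) else 0) - (if r = p.1 then (1 : ℝ) else 0)))).subset ?_
  rintro _ ⟨i, j, -, k, rfl⟩
  exact ⟨(i, j, k), rfl⟩

/-- If good `ℓ` is owned by `a ℓ`, the envy of `i` towards the bundle of `j` with one good `k`
removed is a sum of the shifts `v_{ℓi} (e_j - e_i)` evaluated at the owners. -/
theorem sum_erase_shift {m n : ℕ} (v : Fin m → Fin n → ℝ) {a : Fin m → Fin n}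
    {X : Fin n → Finset (Fin m)} (hX : ∀ ℓ r, ℓ ∈ X r ↔ a ℓ = r) {i j : Fin n} (hij : i ≠ j)
    {k : Fin m} (hk : k ∈ X j) :
    ∑ ℓ ∈ Finset.univ.erase k, v ℓ i *
        ((if a ℓ = j then (1 : ℝ) else 0) - (if a ℓ = i then (1 : ℝ) else 0))
      = (∑ ℓ ∈ X j, v ℓ i) - v k i - ∑ ℓ ∈ X i, v ℓ i := by
  have hbundle : ∀ r, ∑ ℓ ∈ X r, v ℓ i = ∑ ℓ, if a ℓ = r then v ℓ i else 0 := fun r => by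
    rw [← Finset.sum_filter]
    exact Finset.sum_congr (by ext ℓ; simp [hX]) fun _ _ => rfl
  have hsplit := Finset.add_sum_erase Finset.univ (fun ℓ => v ℓ i *
    ((if a ℓ = j then (1 : ℝ) else 0) - (if a ℓ = i then (1 : ℝ) else 0))) (Finset.mem_univ k)
  have hka : a k = j := (hX k j).1 hk
  simp only [hka, if_true, if_neg hij.symm, mul_sub, mul_ite, mul_one, mul_zero,
    Finset.sum_sub_distrib] at hsplit ⊢
  rw [hbundle i, hbundle j]
  linarith

theorem IsEFX.exists_owner {m n : ℕ} {v : Fin m → Fin n → ℝ} {X : Fin n → Finset (Fin m)}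
    (h : IsEFX v X) : ∃ a : Fin m → Fin n, ∀ ℓ r, ℓ ∈ X r ↔ a ℓ = r := by
  have hcover : ∀ ℓ, ∃ r, ℓ ∈ X r := fun ℓ => by
    have := h.2.1 ▸ Finset.mem_univ ℓ
    simpa using this
  choose a ha using hcover
  refine ⟨a, fun ℓ r => ⟨fun hr => ?_, fun hr => hr ▸ ha ℓ⟩⟩
  by_contra hne
  exact Finset.disjoint_left.1 (h.1 _ _ hne) (ha ℓ) hr

/-- An EFX allocation makes the objective nonpositive at a large multiple of its indicator. -/
theorem IsEFX.exists_fobj_nonpos {m n : ℕ} [Nonempty (Fin n)] {v : Fin m → Fin n → ℝ}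
    (hv : ∀ k i, 0 ≤ v k i) {X : Fin n → Finset (Fin m)} (h : IsEFX v X) :
    ∃ y : Fin m → Fin n → ℝ, fobj v y ≤ 0 := by
  obtain ⟨a, ha⟩ := h.exists_owner
  set C : ℝ := 2 * ∑ i, ∑ ℓ, v ℓ i
  have hsum : ∀ i, 2 * ∑ ℓ, v ℓ i ≤ C := fun i =>
    mul_le_mul_of_nonneg_left (Finset.single_le_sum (f := fun i => ∑ ℓ, v ℓ i)
      (fun i _ => Finset.sum_nonneg fun ℓ _ => hv ℓ i) (Finset.mem_univ i)) zero_le_two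
  have hC : ∀ ℓ i, 2 * v ℓ i ≤ C := fun ℓ i =>
    (mul_le_mul_of_nonneg_left (Finset.single_le_sum (f := fun ℓ => v ℓ i)
      (fun ℓ _ => hv ℓ i) (Finset.mem_univ ℓ)) zero_le_two).trans (hsum i)
  have hC0 : 0 ≤ C :=
    mul_nonneg zero_le_two (Finset.sum_nonneg fun i _ => Finset.sum_nonneg fun ℓ _ => hv ℓ i)
  refine ⟨fun ℓ r => if r = a ℓ then C else 0, ?_⟩
  have hrow : ∀ ℓ, C ≤ rowMax (fun r => if r = a ℓ then C else 0) := fun ℓ => by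
    simpa using le_rowMax (fun r => if r = a ℓ then C else 0) (a ℓ)
  have hrows : ∑ _ℓ : Fin m, C ≤ ∑ ℓ, rowMax (fun r => if r = a ℓ then C else 0) :=
    Finset.sum_le_sum fun ℓ _ => hrow ℓ
  refine sub_nonpos.2 (le_trans (Real.sSup_le ?_ (Finset.sum_nonneg fun _ _ => hC0)) hrows)
  rintro _ ⟨i, j, hij, k, rfl⟩
  have hshift : ∀ ℓ, rowMax (fun r => (if r = a ℓ then C else 0) +
      v ℓ i * ((if r = j then (1 : ℝ) else 0) - (if r = i then (1 : ℝ) else 0))) ≤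
      C + v ℓ i * ((if a ℓ = j then (1 : ℝ) else 0) - (if a ℓ = i then (1 : ℝ) else 0)) := by
    refine fun ℓ => rowMax_le fun r => ?_
    by_cases hr : r = a ℓ
    · simp [hr]
    · have h1 := hv ℓ i
      have h2 := hC ℓ i
      simp only [if_neg hr]
      split_ifs <;> linarith
  have hbound := Finset.sum_le_sum fun ℓ (_ : ℓ ∈ Finset.univ.erase k) => hshift ℓ
  rw [Finset.sum_add_distrib] at hbound
  rw [← Finset.add_sum_erase Finset.univ (fun _ => C) (Finset.mem_univ k)]
  by_cases hk : a k = j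
  · have hkj : k ∈ X j := (ha k j).2 hk
    have hefx := h.2.2 i j k hkj
    rw [sum_erase_shift v ha hij hkj] at hbound
    simp only [hk, if_true]
    linarith
  · have hle : ∑ ℓ ∈ Finset.univ.erase k, v ℓ i *
        ((if a ℓ = j then (1 : ℝ) else 0) - (if a ℓ = i then (1 : ℝ) else 0)) ≤ ∑ ℓ, v ℓ i := by
      refine (Finset.sum_le_sum fun ℓ _ => ?_).trans (Finset.sum_le_sum_of_subset_of_nonneg
        (Finset.erase_subset k _) fun ℓ _ _ => hv ℓ i)
      have h1 := hv ℓ i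
      split_ifs <;> linarith
    have h2 := hsum i
    simp only [if_neg (Ne.symm hk)]
    linarith

/-- Giving each good to an agent attaining its row maximum bounds every EFX violation by the
objective. -/
theorem envy_le_fobj {m n : ℕ} (v y : Fin m → Fin n → ℝ) {a : Fin m → Fin n}
    (hmax : ∀ ℓ, y ℓ (a ℓ) = rowMax (y ℓ)) {X : Fin n → Finset (Fin m)}
    (hX : ∀ ℓ r, ℓ ∈ X r ↔ a ℓ = r) {i j : Fin n} (hij : i ≠ j) {k : Fin m} (hk : k ∈ X j) :
    (∑ ℓ ∈ X j, v ℓ i) - v k i - ∑ ℓ ∈ X i, v ℓ i ≤ fobj v y := by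
  refine le_trans ?_ (le_fobj v y hij k)
  have hbound := Finset.sum_le_sum fun ℓ (_ : ℓ ∈ Finset.univ.erase k) =>
    le_rowMax (fun r => y ℓ r +
      v ℓ i * ((if r = j then (1 : ℝ) else 0) - (if r = i then (1 : ℝ) else 0))) (a ℓ)
  rw [Finset.sum_add_distrib, sum_erase_shift v hX hij hk] at hbound
  simp only [hmax] at hbound
  rw [← Finset.add_sum_erase Finset.univ (fun ℓ => rowMax (y ℓ)) (Finset.mem_univ k), ← hmax k,
    (hX k j).1 hk]
  linarith

/-- An allocation that is not EFX has a violation between two distinct agents. -/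
theorem exists_envy_of_not_isEFX {m n : ℕ} {v : Fin m → Fin n → ℝ} (hv : ∀ k i, 0 ≤ v k i)
    {a : Fin m → Fin n} {X : Fin n → Finset (Fin m)} (hX : ∀ ℓ r, ℓ ∈ X r ↔ a ℓ = r)
    (h : ¬ IsEFX v X) :
    ∃ i j, i ≠ j ∧ ∃ k ∈ X j, 0 < (∑ ℓ ∈ X j, v ℓ i) - v k i - ∑ ℓ ∈ X i, v ℓ i := by
  by_contra! hcon
  refine h ⟨fun i j hij => Finset.disjoint_left.2 fun ℓ hi hj =>
    hij (((hX ℓ i).1 hi).symm.trans ((hX ℓ j).1 hj)), ?_, fun i j k hk => ?_⟩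
  · ext ℓ
    simp [hX]
  · rcases eq_or_ne i j with rfl | hij
    · linarith [hv k i]
    · linarith [hcon i j hij k hk]

/-- An EFX allocation exists if and only if
`inf_{y ∈ ℝ^{m×n}} f(y) ≤ 0`; equivalently, an EFX allocation exists if and only
if for every `δ > 0` there exists `y ∈ ℝ^{m×n}` with `f(y) < δ`. -/
theorem stmt_8 (m n : ℕ) (hm : 1 ≤ m) (hn : 2 ≤ n)
    (v : Fin m → Fin n → ℝ) (hv : ∀ k i, 0 ≤ v k i) :
    (∃ X : Fin n → Finset (Fin m), IsEFX v X) ↔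
      (∀ δ : ℝ, 0 < δ → ∃ y : Fin m → Fin n → ℝ, fobj v y < δ) := by
  have : Nonempty (Fin n) := ⟨⟨0, by omega⟩⟩
  constructor
  · rintro ⟨X, hX⟩ δ hδ
    obtain ⟨y, hy⟩ := hX.exists_fobj_nonpos hv
    exact ⟨y, hy.trans_lt hδ⟩
  · intro h
    by_contra! hno
    let X : (Fin m → Fin n) → Fin n → Finset (Fin m) := fun a r => {ℓ | a ℓ = r}
    have hX : ∀ a ℓ r, ℓ ∈ X a r ↔ a ℓ = r := fun a ℓ r => by simp [X]
    choose i j hij k hk hpos using fun a => exists_envy_of_not_isEFX hv (hX a) (hno (X a))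
    obtain ⟨b, hb⟩ := Finite.exists_min fun a =>
      (∑ ℓ ∈ X a (j a), v ℓ (i a)) - v (k a) (i a) - ∑ ℓ ∈ X a (i a), v ℓ (i a)
    obtain ⟨y, hy⟩ := h _ (hpos b)
    choose a ha using fun ℓ => exists_eq_rowMax (y ℓ)
    exact absurd (((hb a).trans (envy_le_fobj v y ha (hX a) (hij a) (hk a))).trans_lt hy)
      (lt_irrefl _)
end

section
/- Fix y ∈ ℝ^{m×n} and for each λ > 0 define the softmax matrix x(λ) ∈ P by x(λ)_{ℓi} = e^{λ y_{ℓi}} / Σ_{r=1}^n e^{λ y_{ℓr}}. Then lim_{λ → ∞} g(x(λ), λ) = f(y). -/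
open Filter Topology

/-- `F` is eventually positive and grows like `exp (a * t)` up to subexponential factors. -/
def HasExpRate (F : ℝ → ℝ) (a : ℝ) : Prop :=
  (∀ᶠ t in atTop, 0 < F t) ∧ Tendsto (fun t => Real.log (F t) / t) atTop (𝓝 a)

namespace HasExpRate

lemma exp (a : ℝ) : HasExpRate (fun t => Real.exp (t * a)) a := by
  refine ⟨Eventually.of_forall fun t => Real.exp_pos _, ?_⟩
  refine tendsto_const_nhds.congr' ?_
  filter_upwards [eventually_gt_atTop 0] with t ht
  rw [Real.log_exp]
  field_simp

lemma mul {F G : ℝ → ℝ} {a b : ℝ} (hF : HasExpRate F a) (hG : HasExpRate G b) :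
    HasExpRate (fun t => F t * G t) (a + b) := by
  refine ⟨?_, (hF.2.add hG.2).congr' ?_⟩
  · filter_upwards [hF.1, hG.1] with t h₁ h₂ using mul_pos h₁ h₂
  · filter_upwards [hF.1, hG.1] with t h₁ h₂
    rw [Real.log_mul h₁.ne' h₂.ne', add_div]

lemma div {F G : ℝ → ℝ} {a b : ℝ} (hF : HasExpRate F a) (hG : HasExpRate G b) :
    HasExpRate (fun t => F t / G t) (a - b) := by
  refine ⟨?_, (hF.2.sub hG.2).congr' ?_⟩
  · filter_upwards [hF.1, hG.1] with t h₁ h₂ using div_pos h₁ h₂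
  · filter_upwards [hF.1, hG.1] with t h₁ h₂
    rw [Real.log_div h₁.ne' h₂.ne', sub_div]

lemma prod {ι : Type*} {s : Finset ι} {F : ι → ℝ → ℝ} {a : ι → ℝ}
    (h : ∀ i ∈ s, HasExpRate (F i) (a i)) :
    HasExpRate (fun t => ∏ i ∈ s, F i t) (∑ i ∈ s, a i) := by
  have hpos : ∀ᶠ t in atTop, ∀ i ∈ s, 0 < F i t :=
    (eventually_all_finset s).2 fun i hi => (h i hi).1
  refine ⟨?_, (tendsto_finsetSum s fun i hi => (h i hi).2).congr' ?_⟩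
  · filter_upwards [hpos] with t ht using Finset.prod_pos ht
  · filter_upwards [hpos] with t ht
    rw [Real.log_prod fun i hi => (ht i hi).ne', Finset.sum_div]

/-- The rate of a finite sum is the largest of the rates of its terms. -/
lemma sum {ι : Type*} {s : Finset ι} {F : ι → ℝ → ℝ} {a : ι → ℝ} {b : ℝ}
    (h : ∀ i ∈ s, HasExpRate (F i) (a i)) (hb : ∃ i ∈ s, a i = b) (hle : ∀ i ∈ s, a i ≤ b) :
    HasExpRate (fun t => ∑ i ∈ s, F i t) b := by
  have hpos : ∀ᶠ t in atTop, ∀ i ∈ s, 0 < F i t :=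
    (eventually_all_finset s).2 fun i hi => (h i hi).1
  obtain ⟨j, hj, rfl⟩ := hb
  have hs : s.Nonempty := ⟨j, hj⟩
  refine ⟨?_, tendsto_order.2 ⟨fun c hc => ?_, fun c hc => ?_⟩⟩
  · filter_upwards [hpos] with t ht using Finset.sum_pos ht hs
  · filter_upwards [hpos, (h j hj).2.eventually_const_lt hc, eventually_gt_atTop 0]
      with t ht hct h0
    refine hct.trans_le (div_le_div_of_nonneg_right ?_ h0.le)
    exact Real.log_le_log (ht j hj)
      (Finset.single_le_sum (f := fun i => F i t) (fun i hi => (ht i hi).le) hj)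
  · obtain ⟨d, hd, hdc⟩ := exists_between hc
    have hlt : ∀ᶠ t in atTop, ∀ i ∈ s, Real.log (F i t) / t < d :=
      (eventually_all_finset s).2 fun i hi =>
        (h i hi).2.eventually_lt_const ((hle i hi).trans_lt hd)
    have hlim : Tendsto (fun t : ℝ => Real.log s.card / t + d) atTop (𝓝 d) := by
      simpa using (tendsto_const_nhds.div_atTop tendsto_id).add_const d
    filter_upwards [hpos, hlt, hlim.eventually_lt_const hdc, eventually_gt_atTop 0]
      with t ht hdt hct h0
    refine lt_of_le_of_lt ?_ hct
    have hsum : ∑ i ∈ s, F i t ≤ s.card * Real.exp (d * t) := by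
      rw [← nsmul_eq_mul]
      refine Finset.sum_le_card_nsmul s _ _ fun i hi => ?_
      rw [← Real.log_le_iff_le_exp (ht i hi)]
      exact ((div_lt_iff₀ h0).1 (hdt i hi)).le
    have hcard : (s.card : ℝ) ≠ 0 := by exact_mod_cast hs.card_pos.ne'
    have hlog := Real.log_le_log (Finset.sum_pos ht hs) hsum
    rw [Real.log_mul hcard (Real.exp_pos _).ne', Real.log_exp] at hlog
    rw [div_le_iff₀ h0, add_mul, div_mul_cancel₀ _ h0.ne']
    exact hlog

end HasExpRate

lemma hasExpRate_sum_exp {n : ℕ} [NeZero n] (z : Fin n → ℝ) :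
    HasExpRate (fun t => ∑ r, Real.exp (t * z r)) (rowMax z) := by
  have hfin := Set.finite_range z
  obtain ⟨r, hr⟩ := (Set.range_nonempty z).csSup_mem hfin
  exact HasExpRate.sum (fun i _ => HasExpRate.exp (z i)) ⟨r, Finset.mem_univ r, hr⟩
    fun i _ => le_csSup hfin.bddAbove ⟨i, rfl⟩

/-- Transferring a good from `i` to `j` turns the softmax factor of `gfun` into a quotient of
partition functions. -/
lemma softmax_factor_eq {n : ℕ} [NeZero n] (z : Fin n → ℝ) (w t : ℝ) {i j : Fin n} (hij : i ≠ j) :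
    1 - Real.exp (t * z i) / (∑ r, Real.exp (t * z r))
        - Real.exp (t * z j) / (∑ r, Real.exp (t * z r))
        + Real.exp (t * z i) / (∑ r, Real.exp (t * z r)) * Real.exp (-t * w)
        + Real.exp (t * z j) / (∑ r, Real.exp (t * z r)) * Real.exp (t * w)
      = (∑ r, Real.exp (t * (z r +
          w * ((if r = j then (1 : ℝ) else 0) - (if r = i then (1 : ℝ) else 0)))))
        / ∑ r, Real.exp (t * z r) := by
  have hS : 0 < ∑ r, Real.exp (t * z r) :=
    Finset.sum_pos (fun r _ => Real.exp_pos _) Finset.univ_nonempty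
  have hterm : ∀ r, Real.exp (t * (z r +
      w * ((if r = j then (1 : ℝ) else 0) - (if r = i then (1 : ℝ) else 0))))
      = Real.exp (t * z r)
        + (if r = i then Real.exp (t * z i) * (Real.exp (-t * w) - 1) else 0)
        + (if r = j then Real.exp (t * z j) * (Real.exp (t * w) - 1) else 0) := by
    intro r
    by_cases hi : r = i
    · subst hi
      simp only [if_neg hij, if_true, mul_sub, ← Real.exp_add]
      ring_nf
    · by_cases hj : r = j
      · subst hj
        simp only [if_neg hi, if_true, mul_sub, ← Real.exp_add]
        ring_nf
      · simp [hi, hj]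
  simp only [hterm, Finset.sum_add_distrib, Finset.sum_ite_eq', Finset.mem_univ, if_true]
  field_simp
  ring

/-- Fix `y ∈ ℝ^{m×n}` and for each `λ > 0` define the softmax matrix
`x(λ)_{ℓi} = e^{λ y_{ℓi}} / Σ_r e^{λ y_{ℓr}}`. Then `lim_{λ→∞} g(x(λ), λ) = f(y)`. -/
theorem stmt_9 (m n : ℕ) (hm : 1 ≤ m) (hn : 2 ≤ n)
    (v : Fin m → Fin n → ℝ) (hv : ∀ k i, 0 ≤ v k i)
    (y : Fin m → Fin n → ℝ) :
    Filter.Tendsto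
      (fun lam : ℝ =>
        gfun v (fun ℓ i => Real.exp (lam * y ℓ i) / ∑ r, Real.exp (lam * y ℓ r)) lam)
      Filter.atTop (nhds (fobj v y)) := by
  have : NeZero n := ⟨by omega⟩
  set C := ∑ ℓ, rowMax (y ℓ) with hC
  let A : (Fin n × Fin n) × Fin m → ℝ := fun q => y q.2 q.1.2 + ∑ ℓ ∈ Finset.univ.erase q.2,
    rowMax (fun r => y ℓ r + v ℓ q.1.1 *
      ((if r = q.1.2 then (1 : ℝ) else 0) - (if r = q.1.1 then (1 : ℝ) else 0)))
  let s : Finset ((Fin n × Fin n) × Fin m) :=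
    (Finset.univ.filter fun p : Fin n × Fin n => p.1 ≠ p.2) ×ˢ Finset.univ
  have hs : s.Nonempty :=
    ⟨((⟨0, by omega⟩, ⟨1, by omega⟩), ⟨0, by omega⟩), by simp [s]⟩
  have hf : fobj v y = sSup (A '' s) - C := by
    unfold fobj
    congr 2
    ext z
    constructor
    · rintro ⟨i, j, hij, k, rfl⟩
      exact ⟨((i, j), k), by simpa [s] using hij, rfl⟩
    · rintro ⟨⟨⟨i, j⟩, k⟩, hq, rfl⟩
      exact ⟨i, j, by simpa [s] using hq, k, rfl⟩
  have hfin : (A '' s).Finite := s.finite_toSet.image A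
  have hrate : ∀ q ∈ s, HasExpRate
      (fun t => Real.exp (t * y q.2 q.1.2) / (∑ r, Real.exp (t * y q.2 r)) *
        ∏ ℓ ∈ Finset.univ.erase q.2, (∑ r, Real.exp (t * (y ℓ r + v ℓ q.1.1 *
          ((if r = q.1.2 then (1 : ℝ) else 0) - (if r = q.1.1 then (1 : ℝ) else 0)))))
          / ∑ r, Real.exp (t * y ℓ r)) (A q - C) := by
    intro q _
    have hAC : A q - C = (y q.2 q.1.2 - rowMax (y q.2)) + ∑ ℓ ∈ Finset.univ.erase q.2,
        (rowMax (fun r => y ℓ r + v ℓ q.1.1 *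
          ((if r = q.1.2 then (1 : ℝ) else 0) - (if r = q.1.1 then (1 : ℝ) else 0)))
          - rowMax (y ℓ)) := by
      rw [hC, ← Finset.add_sum_erase _ _ (Finset.mem_univ q.2), Finset.sum_sub_distrib]
      ring
    rw [hAC]
    exact ((HasExpRate.exp _).div (hasExpRate_sum_exp _)).mul
      (HasExpRate.prod fun ℓ _ =>
        (hasExpRate_sum_exp (n := n) _).div (hasExpRate_sum_exp (n := n) _))
  have hsum := HasExpRate.sum (b := sSup (A '' s) - C) hrate
    (by
      obtain ⟨q, hq, hqb⟩ := (hs.to_set.image A).csSup_mem hfin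
      exact ⟨q, hq, by rw [hqb]⟩)
    (fun q hq => sub_le_sub_right (le_csSup hfin.bddAbove ⟨q, hq, rfl⟩) C)
  rw [hf]
  refine hsum.2.congr fun t => ?_
  unfold gfun
  rw [div_eq_mul_inv, mul_comm, ← one_div]
  simp only [s, Finset.sum_product]
  congr 2
  refine Finset.sum_congr rfl fun p hp => Finset.sum_congr rfl fun k _ => ?_
  congr 1
  exact Finset.prod_congr rfl fun ℓ _ =>
    (softmax_factor_eq (n := n) (y ℓ) (v ℓ p.1) t (Finset.mem_filter.1 hp).2).symm
end
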